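/- Let n ≥ 3, N ≥ 1 and r > 0, and let ψ be a ℂ^N-valued map that is continuously differentiable on a neighborhood of the closed ball B̄_r(0) ⊂ ℝⁿ. Then ∫_{B_r} |ψ(x)|² dx ≤ r² ∫_{B_r} |ψ(x)|²/|x|² dx ≤ (2/(n−2)) r ∫_{∂B_r} |ψ|² dS + (4/(n−2)²) r² ∫_{B_r} |∇ψ|² dx, where |∇ψ(x)|² = Σ_{j=1}^n |∂_j ψ(x)|². -/

import Mathlib

open MeasureTheory Set Metric
open scoped ENNReal NNReal Pointwise

/-- Integration in polar coordinates, for the Lebesgue integral of a nonnegative function. -/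
theorem lintegral_eq_lintegral_sphere_lintegral_Ioi {E : Type*} [NormedAddCommGroup E]
    [InnerProductSpace ℝ E] [FiniteDimensional ℝ E] [MeasurableSpace E] [BorelSpace E] {m : ℕ}
    (hE : Module.finrank ℝ E = m + 1) {F : E → ℝ≥0∞} (hF : Measurable F) :
    ∫⁻ x, F x = ∫⁻ ω : sphere (0 : E) 1,
      (∫⁻ t in Ioi (0 : ℝ), ENNReal.ofReal (t ^ m) * F (t • (ω : E)))
        ∂(volume : Measure E).toSphere := by
  have : Nontrivial E := Module.nontrivial_of_finrank_pos (R := ℝ) (hE ▸ m.succ_pos)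
  let G : sphere (0 : E) 1 × Ioi (0 : ℝ) → ℝ≥0∞ := fun p ↦ F (p.2.1 • p.1.1)
  have hG : Measurable G := hF.comp (by fun_prop)
  calc ∫⁻ x, F x = ∫⁻ x : ({(0)}ᶜ : Set E), F x.1 ∂(Measure.comap Subtype.val volume) := by
        rw [lintegral_subtype_comap (measurableSet_singleton _).compl F, restrict_compl_singleton]
    _ = ∫⁻ x : ({(0)}ᶜ : Set E), G (homeomorphUnitSphereProd E x)
          ∂(Measure.comap Subtype.val volume) := by
        refine lintegral_congr fun x ↦ ?_
        have hx : ‖x.1‖ ≠ 0 := norm_ne_zero_iff.2 x.2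
        simp [G, smul_smul, hx]
    _ = ∫⁻ p, G p ∂((volume : Measure E).toSphere.prod (.volumeIoiPow m)) := by
        have h := (volume : Measure E).measurePreserving_homeomorphUnitSphereProd
        rw [hE, Nat.add_sub_cancel] at h
        exact h.lintegral_comp hG
    _ = ∫⁻ ω, ∫⁻ t, G (ω, t) ∂(.volumeIoiPow m) ∂(volume : Measure E).toSphere :=
        lintegral_prod _ hG.aemeasurable
    _ = _ := by
        refine lintegral_congr fun ω ↦ ?_
        rw [Measure.volumeIoiPow]
        refine (lintegral_withDensity_eq_lintegral_mul _ (by fun_prop)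
          (hG.comp measurable_prodMk_left)).trans ?_
        exact lintegral_subtype_comap measurableSet_Ioi
          fun t : ℝ ↦ ENNReal.ofReal (t ^ m) * F (t • ω.1)

theorem measurableSet_Ioo_smul {E : Type*} [NormedAddCommGroup E]
    [NormedSpace ℝ E] [MeasurableSpace E] [BorelSpace E] {S : Set E}
    (hS : MeasurableSet S) (hnorm : S ⊆ sphere 0 1) :
    MeasurableSet (Ioo (0 : ℝ) 1 • S) := by
  have : Ioo (0 : ℝ) 1 • S = {x | x ≠ 0} ∩ {x | ‖x‖ < 1} ∩ (fun x : E ↦ ‖x‖⁻¹ • x) ⁻¹' S := by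
    ext x
    simp only [mem_smul, mem_inter_iff, mem_ofPred_eq, mem_preimage]
    constructor
    · rintro ⟨t, ht, a, ha, rfl⟩
      have ha1 : ‖a‖ = 1 := by simpa using hnorm ha
      have ha0 : a ≠ 0 := by rintro rfl; simp at ha1
      have hn : ‖t • a‖ = t := by rw [norm_smul, ha1, mul_one, Real.norm_of_nonneg ht.1.le]
      refine ⟨⟨smul_ne_zero ht.1.ne' ha0, hn.symm ▸ ht.2⟩, ?_⟩
      rwa [hn, smul_smul, inv_mul_cancel₀ ht.1.ne', one_smul]
    · rintro ⟨⟨h0, h1⟩, hx⟩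
      refine ⟨‖x‖, ⟨norm_pos_iff.2 h0, h1⟩, _, hx, ?_⟩
      rw [smul_smul, mul_inv_cancel₀ (norm_ne_zero_iff.2 h0), one_smul]
  rw [this]
  have hm : Measurable fun x : E ↦ ‖x‖⁻¹ • x :=
    measurable_of_continuousOn_compl_singleton 0 <|
      (continuousOn_id.norm.inv₀ fun x hx ↦ norm_ne_zero_iff.2 hx).smul continuousOn_id
  exact ((measurableSet_singleton (0 : E)).compl.inter
    (measurableSet_lt measurable_norm measurable_const)).inter (hm hS)

/-- The gnomonic chart `a ↦ (aᵢ / a₀)ᵢ` is Lipschitz for the sup norm on the cap `c < a₀` of the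
unit sphere. -/
theorem lipschitzOnWith_gnomonic {m : ℕ} {c : ℝ} (hc : 0 < c) :
    LipschitzOnWith (Real.toNNReal (c ^ 2)⁻¹)
      (fun (a : EuclideanSpace ℝ (Fin (m + 1))) (i : Fin m) ↦ a i.succ / a 0)
      {a | ‖a‖ = 1 ∧ c < a 0} := by
  refine LipschitzOnWith.of_dist_le_mul fun a ha b hb ↦ ?_
  have hK : (0 : ℝ) ≤ (c ^ 2)⁻¹ := by positivity
  rw [Real.coe_toNNReal _ hK, dist_pi_le_iff (by positivity)]
  intro i
  have ha0 : 0 < a 0 := hc.trans ha.2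
  have hb0 : 0 < b 0 := hc.trans hb.2
  have key : ∀ v : EuclideanSpace ℝ (Fin (m + 1)), v 0 ^ 2 + v i.succ ^ 2 ≤ ‖v‖ ^ 2 := by
    intro v
    rw [EuclideanSpace.real_norm_sq_eq, Fin.sum_univ_succ]
    gcongr
    exact Finset.single_le_sum (f := fun j : Fin m ↦ v j.succ ^ 2)
      (fun _ _ ↦ sq_nonneg _) (Finset.mem_univ i)
  have h1 := key (a - b)
  have h2 := key b
  rw [hb.1] at h2
  simp only [PiLp.sub_apply] at h1
  rw [dist_eq_norm a b, Real.dist_eq, div_sub_div _ _ ha0.ne' hb0.ne', abs_div,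
    abs_of_pos (mul_pos ha0 hb0)]
  have h3 : |a i.succ * b 0 - a 0 * b i.succ| ≤ ‖a - b‖ := by
    refine abs_le_of_sq_le_sq ?_ (norm_nonneg _)
    calc (a i.succ * b 0 - a 0 * b i.succ) ^ 2
        = ((a i.succ - b i.succ) * b 0 - (a 0 - b 0) * b i.succ) ^ 2 := by ring
      _ ≤ ((a 0 - b 0) ^ 2 + (a i.succ - b i.succ) ^ 2) * (b 0 ^ 2 + b i.succ ^ 2) := by
          nlinarith [sq_nonneg ((a i.succ - b i.succ) * b i.succ + (a 0 - b 0) * b 0)]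
      _ ≤ ‖a - b‖ ^ 2 * 1 := by
          refine mul_le_mul h1 (by simpa using h2) (by positivity) (by positivity)
      _ = _ := mul_one _
  rw [inv_mul_eq_div]
  refine div_le_div₀ (norm_nonneg _) h3 (by positivity) ?_
  nlinarith [ha.2, hb.2]

/-- The volume of the cone over a subset of a spherical cap is controlled by the Hausdorff measure
of that subset, with a constant that tends to the optimal one as the cap shrinks. -/
theorem volume_Ioo_smul_le_of_cap {m : ℕ} {c : ℝ} (hc : 0 < c)
    {S : Set (EuclideanSpace ℝ (Fin (m + 1)))} (hS : MeasurableSet S)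
    (hcap : S ⊆ {a | ‖a‖ = 1 ∧ c < a 0}) :
    ((m : ℝ≥0∞) + 1) * volume (Ioo (0 : ℝ) 1 • S) ≤
      ENNReal.ofReal (c ^ 2)⁻¹ ^ m * μH[(m : ℝ)] S := by
  set φ : EuclideanSpace ℝ (Fin (m + 1)) → Fin m → ℝ := fun a i ↦ a i.succ / a 0
  have hφ : volume (φ '' S) ≤ ENNReal.ofReal (c ^ 2)⁻¹ ^ m * μH[(m : ℝ)] S := by
    have h := ((lipschitzOnWith_gnomonic hc).mono hcap).hausdorffMeasure_image_le
      (Nat.cast_nonneg m)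
    rw [ENNReal.rpow_natCast] at h
    have hv := hausdorffMeasure_pi_real (ι := Fin m)
    rw [Fintype.card_fin] at hv
    rwa [hv] at h
  have hC := measurableSet_Ioo_smul hS fun a ha ↦ by simpa using (hcap ha).1
  set C := Ioo (0 : ℝ) 1 • S
  let e := (MeasurableEquiv.toLp 2 (Fin (m + 1) → ℝ)).symm.trans
    (MeasurableEquiv.piFinSuccAbove (fun _ : Fin (m + 1) ↦ ℝ) 0)
  have he : MeasurePreserving e :=
    (volume_preserving_piFinSuccAbove (fun _ : Fin (m + 1) ↦ ℝ) 0).comp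
      (EuclideanSpace.volume_preserving_symm_measurableEquiv_toLp (Fin (m + 1)))
  have hvol : volume C = ∫⁻ s : ℝ, volume (Prod.mk s ⁻¹' (e.symm ⁻¹' C)) := by
    rw [← he.symm.measure_preimage_equiv, Measure.volume_eq_prod,
      Measure.prod_apply (e.symm.measurable hC)]
  have hslice : ∀ s : ℝ, volume (Prod.mk s ⁻¹' (e.symm ⁻¹' C)) ≤
      (Ioo (0 : ℝ) 1).indicator (fun s ↦ ENNReal.ofReal (s ^ m) * volume (φ '' S)) s := by
    intro s
    have hmem : ∀ y : Fin m → ℝ, e.symm (s, y) ∈ C → s ∈ Ioo (0 : ℝ) 1 ∧ y ∈ s • (φ '' S) := by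
      intro y hy
      obtain ⟨t, ht, a, ha, hta⟩ := hy
      have ha0 : 0 < a 0 := hc.trans (hcap ha).2
      change t • a = e.symm (s, y) at hta
      have h2 : e (t • a) = (s, y) := by rw [hta, e.apply_symm_apply]
      have hs : t * a 0 = s := congrArg Prod.fst h2
      have hy : ∀ i, t * a i.succ = y i := fun i ↦ congrFun (congrArg Prod.snd h2) i
      have ha1 : a 0 ≤ 1 := by
        have := PiLp.norm_apply_le a 0
        rw [(hcap ha).1] at this
        exact (le_abs_self _).trans this
      refine ⟨⟨hs ▸ mul_pos ht.1 ha0, ?_⟩, φ a, mem_image_of_mem _ ha, ?_⟩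
      · rw [← hs]; nlinarith [ht.1, ht.2]
      · ext i
        simp only [φ, Pi.smul_apply, smul_eq_mul, ← hs, ← hy i]
        field_simp
    by_cases hs : s ∈ Ioo (0 : ℝ) 1
    · rw [indicator_of_mem hs]
      refine (measure_mono (fun y hy ↦ (hmem y hy).2)).trans_eq ?_
      rw [Measure.addHaar_smul, Module.finrank_fin_fun, abs_of_nonneg (pow_nonneg hs.1.le _)]
    · rw [indicator_of_notMem hs]
      refine (measure_mono_null (t := ∅) (fun y hy ↦ (hs (hmem y hy).1).elim) (by simp)).le
  have hint : ∫⁻ s in Ioo (0 : ℝ) 1, ENNReal.ofReal (s ^ m) = ((m : ℝ≥0∞) + 1)⁻¹ := by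
    rw [restrict_Ioo_eq_restrict_Ioc, ← ofReal_integral_eq_lintegral_ofReal,
      ← intervalIntegral.integral_of_le zero_le_one, integral_pow]
    · rw [one_pow, zero_pow (Nat.succ_ne_zero m), sub_zero, one_div,
        ENNReal.ofReal_inv_of_pos (by positivity), ENNReal.ofReal_add (by positivity) zero_le_one]
      simp
    · exact (intervalIntegral.intervalIntegrable_pow m).1
    · filter_upwards [ae_restrict_mem measurableSet_Ioc] with s hs using pow_nonneg hs.1.le _
  calc ((m : ℝ≥0∞) + 1) * volume C
      ≤ ((m : ℝ≥0∞) + 1) * ∫⁻ s in Ioo (0 : ℝ) 1, ENNReal.ofReal (s ^ m) * volume (φ '' S) := by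
        rw [hvol, ← lintegral_indicator measurableSet_Ioo]
        gcongr with s
        exact hslice s
    _ = volume (φ '' S) := by
        rw [lintegral_mul_const _ (by fun_prop), hint, ← mul_assoc,
          ENNReal.mul_inv_cancel (by simp) (by finiteness), one_mul]
    _ ≤ _ := hφ

theorem volume_Ioo_smul_image {E : Type*} [NormedAddCommGroup E] [InnerProductSpace ℝ E]
    [FiniteDimensional ℝ E] [MeasurableSpace E] [BorelSpace E] (R : E ≃ₗᵢ[ℝ] E) (S : Set E) :
    volume (Ioo (0 : ℝ) 1 • (R '' S)) = volume (Ioo (0 : ℝ) 1 • S) := by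
  have h : Ioo (0 : ℝ) 1 • (R '' S) = R '' (Ioo (0 : ℝ) 1 • S) := by
    ext x
    constructor
    · rintro ⟨t, ht, _, ⟨a, ha, rfl⟩, rfl⟩
      exact ⟨t • a, smul_mem_smul ht ha, R.map_smul t a⟩
    · rintro ⟨_, ⟨t, ht, a, ha, rfl⟩, rfl⟩
      exact ⟨t, ht, R a, mem_image_of_mem _ ha, (R.map_smul t a).symm⟩
  rw [h, R.image_eq_preimage_symm]
  exact R.symm.measurePreserving.measure_preimage_equiv (f := R.symm.toMeasurableEquiv) _

theorem exists_linearIsometryEquiv_apply_zero_eq_one {m : ℕ}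
    {p : EuclideanSpace ℝ (Fin (m + 1))} (hp : ‖p‖ = 1) :
    ∃ R : EuclideanSpace ℝ (Fin (m + 1)) ≃ₗᵢ[ℝ] EuclideanSpace ℝ (Fin (m + 1)), R p 0 = 1 := by
  refine ⟨Submodule.reflection
    (Submodule.span ℝ {p - EuclideanSpace.single (0 : Fin (m + 1)) (1 : ℝ)})ᗮ, ?_⟩
  rw [Submodule.reflection_sub (by simp [hp])]
  simp

theorem toSphere_preimage_coe {m : ℕ} {A : Set (EuclideanSpace ℝ (Fin (m + 1)))}
    (hA : MeasurableSet A) :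
    (volume : Measure (EuclideanSpace ℝ (Fin (m + 1)))).toSphere (Subtype.val ⁻¹' A) =
      ((m : ℝ≥0∞) + 1) * volume (Ioo (0 : ℝ) 1 • (A ∩ sphere 0 1)) := by
  rw [Measure.toSphere_apply' _ (measurable_subtype_coe hA), Subtype.image_preimage_coe,
    inter_comm]
  simp

theorem map_toSphere_le_smul_hausdorffMeasure {m : ℕ} {c : ℝ} (hc : 0 < c) (hc1 : c < 1) :
    (volume : Measure (EuclideanSpace ℝ (Fin (m + 1)))).toSphere.map Subtype.val ≤
      ENNReal.ofReal (c ^ 2)⁻¹ ^ m • (μH[(m : ℝ)]).restrict (sphere 0 1) := by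
  set σ := (volume : Measure (EuclideanSpace ℝ (Fin (m + 1)))).toSphere
  set K := ENNReal.ofReal (c ^ 2)⁻¹ ^ m
  have hσ : ∀ A, MeasurableSet A → σ.map Subtype.val A = σ (Subtype.val ⁻¹' A) :=
    fun A hA ↦ Measure.map_apply measurable_subtype_coe hA
  suffices ∃ T, MeasurableSet T ∧ sphere (0 : EuclideanSpace ℝ (Fin (m + 1))) 1 ⊆ T ∧
      ∀ A ⊆ T, MeasurableSet A → σ.map Subtype.val A ≤ K * μH[(m : ℝ)] (A ∩ sphere 0 1) by
    obtain ⟨T, hT, hST, h⟩ := this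
    refine Measure.le_iff.2 fun A hA ↦ ?_
    have h1 : σ.map Subtype.val A = σ.map Subtype.val (A ∩ T) := by
      rw [hσ _ hA, hσ _ (hA.inter hT)]
      congr 1
      ext x
      simp [hST x.2]
    rw [h1, Measure.smul_apply, Measure.restrict_apply hA, smul_eq_mul]
    refine (h _ inter_subset_right (hA.inter hT)).trans ?_
    gcongr
    exact inter_subset_left
  refine (isCompact_sphere 0 1).induction_on (p := fun s ↦ ∃ T, MeasurableSet T ∧ s ⊆ T ∧
      ∀ A ⊆ T, MeasurableSet A → σ.map Subtype.val A ≤ K * μH[(m : ℝ)] (A ∩ sphere 0 1))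
    ⟨∅, .empty, subset_rfl, fun A hA _ ↦ by simp [subset_empty_iff.1 hA]⟩
    (fun s t hst ⟨T, hT, htT, h⟩ ↦ ⟨T, hT, hst.trans htT, h⟩) ?_ ?_
  · rintro s t ⟨T, hT, hsT, h⟩ ⟨T', hT', htT', h'⟩
    refine ⟨T ∪ T', hT.union hT', union_subset_union hsT htT', fun A hA hAm ↦ ?_⟩
    rw [← measure_inter_add_sdiff A hT, ← measure_inter_add_sdiff (A ∩ sphere 0 1) hT, mul_add]
    refine add_le_add ((h _ inter_subset_right (hAm.inter hT)).trans_eq ?_)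
      ((h' _ ?_ (hAm.diff hT)).trans_eq ?_)
    · rw [inter_right_comm]
    · rintro x ⟨hxA, hxT⟩
      exact (hA hxA).resolve_left hxT
    · congr 2
      ext x
      simp only [mem_inter_iff, mem_sdiff]
      tauto
  · intro p hp
    obtain ⟨R, hR⟩ := exists_linearIsometryEquiv_apply_zero_eq_one (by simpa using hp)
    have hopen : IsOpen {a | c < R a 0} :=
      isOpen_lt continuous_const ((EuclideanSpace.proj 0).continuous.comp R.continuous)
    refine ⟨_, mem_nhdsWithin_of_mem_nhds (hopen.mem_nhds (by simpa [hR] using hc1)), _,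
      hopen.measurableSet, subset_rfl, fun A hA hAm ↦ ?_⟩
    rw [hσ _ hAm, toSphere_preimage_coe hAm, ← volume_Ioo_smul_image R,
      ← R.toIsometryEquiv.hausdorffMeasure_image]
    refine volume_Ioo_smul_le_of_cap hc ?_ ?_
    · rw [R.image_eq_preimage_symm]
      exact R.symm.continuous.measurable (hAm.inter isClosed_sphere.measurableSet)
    · rintro _ ⟨a, ha, rfl⟩
      exact ⟨by simpa using ha.2, hA ha.1⟩

/-- The surface measure on the unit sphere is bounded by the (unnormalized) Hausdorff measure. -/
theorem map_toSphere_le_hausdorffMeasure {m : ℕ} :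
    (volume : Measure (EuclideanSpace ℝ (Fin (m + 1)))).toSphere.map Subtype.val ≤
      (μH[(m : ℝ)]).restrict (sphere 0 1) := by
  refine Measure.le_iff.2 fun A hA ↦ ?_
  have hlim : Filter.Tendsto
      (fun c : ℝ ↦ ENNReal.ofReal (c ^ 2)⁻¹ ^ m * (μH[(m : ℝ)]).restrict
        (sphere (0 : EuclideanSpace ℝ (Fin (m + 1))) 1) A)
      (nhdsWithin 1 (Iio 1))
      (nhds (ENNReal.ofReal (1 ^ 2)⁻¹ ^ m * (μH[(m : ℝ)]).restrict
        (sphere (0 : EuclideanSpace ℝ (Fin (m + 1))) 1) A)) := by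
    refine ENNReal.Tendsto.mul_const ?_ (Or.inl (by simp))
    refine ENNReal.Tendsto.pow (ENNReal.tendsto_ofReal (Filter.Tendsto.mono_left ?_
      nhdsWithin_le_nhds))
    exact ((continuous_pow 2).continuousAt.inv₀ (by norm_num)).tendsto
  rw [one_pow, inv_one, ENNReal.ofReal_one, one_pow, one_mul] at hlim
  refine ge_of_tendsto hlim ?_
  filter_upwards [Ioo_mem_nhdsLT (zero_lt_one' ℝ)] with c hc
  exact map_toSphere_le_smul_hausdorffMeasure hc.1 hc.2 A

theorem lintegral_toSphere_smul_le {m : ℕ} {r : ℝ} (hr : 0 < r)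
    {f : EuclideanSpace ℝ (Fin (m + 1)) → ℝ≥0∞} (hf : Measurable f) :
    ENNReal.ofReal (r ^ m) * ∫⁻ ω : sphere (0 : EuclideanSpace ℝ (Fin (m + 1))) 1,
        f (r • (ω : EuclideanSpace ℝ (Fin (m + 1))))
        ∂(volume : Measure (EuclideanSpace ℝ (Fin (m + 1)))).toSphere ≤
      ∫⁻ x in sphere 0 r, f x ∂μH[(m : ℝ)] := by
  have hmeas : Measurable fun ω : sphere (0 : EuclideanSpace ℝ (Fin (m + 1))) 1 ↦
      r • (ω : EuclideanSpace ℝ (Fin (m + 1))) := by fun_prop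
  rw [← lintegral_map hf hmeas, ← smul_eq_mul, ← lintegral_smul_measure]
  refine lintegral_mono' (Measure.le_iff.2 fun A hA ↦ ?_) le_rfl
  have hA' : MeasurableSet (r⁻¹ • A) := hA.const_smul₀ _
  have h := map_toSphere_le_hausdorffMeasure (m := m) (r⁻¹ • A)
  rw [Measure.map_apply measurable_subtype_coe hA', Measure.restrict_apply hA'] at h
  have hset : r⁻¹ • A ∩ sphere (0 : EuclideanSpace ℝ (Fin (m + 1))) 1 =
      r⁻¹ • (A ∩ sphere 0 r) := by
    rw [smul_set_inter₀ (inv_ne_zero hr.ne'), smul_sphere' (inv_ne_zero hr.ne'), smul_zero,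
      Real.norm_of_nonneg (by positivity), inv_mul_cancel₀ hr.ne']
  have hpre : (fun ω : sphere (0 : EuclideanSpace ℝ (Fin (m + 1))) 1 ↦
      r • (ω : EuclideanSpace ℝ (Fin (m + 1)))) ⁻¹' A = Subtype.val ⁻¹' (r⁻¹ • A) := by
    ext ω
    simp [mem_smul_set_iff_inv_smul_mem₀ (inv_ne_zero hr.ne')]
  rw [Measure.smul_apply, Measure.map_apply hmeas hA, Measure.restrict_apply hA, hpre, smul_eq_mul]
  rw [hset, Measure.hausdorffMeasure_smul₀ (Nat.cast_nonneg m) (inv_ne_zero hr.ne')] at h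
  refine (mul_le_mul_right h _).trans_eq ?_
  have hnn : ENNReal.ofReal (r ^ m) = ((‖r‖₊ ^ m : ℝ≥0) : ℝ≥0∞) := by
    rw [ENNReal.ofReal_pow hr.le, ENNReal.coe_pow]
    congr 1
    rw [← Real.toNNReal_eq_nnnorm_of_nonneg hr.le]
    rfl
  rw [hnn, NNReal.rpow_natCast, ENNReal.smul_def, smul_eq_mul, ← mul_assoc, ← ENNReal.coe_mul,
    ← mul_pow, nnnorm_inv, mul_inv_cancel₀ (by simpa using hr.ne'), one_pow, ENNReal.coe_one,
    one_mul]

theorem hausdorffMeasure_cap_lt_top {m : ℕ} :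
    μH[(m : ℝ)] {a : EuclideanSpace ℝ (Fin (m + 1)) | ‖a‖ = 1 ∧ 1 / 2 < a 0} < ∞ := by
  let g : (Fin m → ℝ) → EuclideanSpace ℝ (Fin (m + 1)) := fun y ↦ WithLp.toLp 2 (Fin.cons 1 y)
  have hg : ContDiff ℝ 1 g := by
    rw [contDiff_euclidean]
    intro i
    refine Fin.cases ?_ (fun j ↦ ?_) i
    · exact contDiff_const
    · exact contDiff_apply ℝ ℝ j
  have hg0 : ∀ y, g y ≠ 0 := fun y h ↦ by simpa [g] using congrArg (fun v ↦ v 0) h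
  have hG : ContDiff ℝ 1 fun y ↦ ‖g y‖⁻¹ • g y :=
    ((hg.norm ℝ hg0).inv fun y ↦ norm_ne_zero_iff.2 (hg0 y)).smul hg
  obtain ⟨K, hK⟩ := (hG.locallyLipschitz.locallyLipschitzOn
    (s := closedBall 0 2)).exists_lipschitzOnWith_of_compact (isCompact_closedBall 0 2)
  have h := hK.hausdorffMeasure_image_le (Nat.cast_nonneg m)
  have hv := hausdorffMeasure_pi_real (ι := Fin m)
  rw [Fintype.card_fin] at hv
  rw [hv, ENNReal.rpow_natCast] at h
  refine (measure_mono ?_).trans_lt (h.trans_lt (ENNReal.mul_lt_top (by finiteness)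
    measure_closedBall_lt_top))
  rintro a ⟨ha, ha0⟩
  have ha0' : 0 < a 0 := by linarith
  refine ⟨fun i ↦ a i.succ / a 0, ?_, ?_⟩
  · rw [mem_closedBall_zero_iff, pi_norm_le_iff_of_nonneg zero_le_two]
    intro i
    have := PiLp.norm_apply_le a i.succ
    rw [norm_div, Real.norm_of_nonneg ha0'.le, div_le_iff₀ ha0']
    linarith
  · have hga : g (fun i ↦ a i.succ / a 0) = (a 0)⁻¹ • a := by
      ext i
      refine Fin.cases ?_ (fun j ↦ ?_) i
      · simp [g, ha0'.ne']
      · simp [g, div_eq_inv_mul]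
    simp only [hga, norm_smul, ha, norm_inv, Real.norm_of_nonneg ha0'.le, mul_one, inv_inv,
      smul_smul, mul_inv_cancel₀ ha0'.ne', one_smul]

theorem hausdorffMeasure_sphere_lt_top {m : ℕ} {r : ℝ} (hr : 0 < r) :
    μH[(m : ℝ)] (sphere (0 : EuclideanSpace ℝ (Fin (m + 1))) r) < ∞ := by
  have h1 : μH[(m : ℝ)] (sphere (0 : EuclideanSpace ℝ (Fin (m + 1))) 1) < ∞ := by
    refine (isCompact_sphere 0 1).measure_lt_top_of_nhdsWithin fun p hp ↦ ?_
    obtain ⟨R, hR⟩ := exists_linearIsometryEquiv_apply_zero_eq_one (by simpa using hp)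
    have hopen : IsOpen {a | 1 / 2 < R a 0} :=
      isOpen_lt continuous_const ((EuclideanSpace.proj 0).continuous.comp R.continuous)
    refine ⟨_, inter_mem_nhdsWithin _ (hopen.mem_nhds (by simp [hR]; norm_num)), ?_⟩
    rw [← R.toIsometryEquiv.hausdorffMeasure_image]
    refine (measure_mono ?_).trans_lt hausdorffMeasure_cap_lt_top
    rintro _ ⟨a, ha, rfl⟩
    exact ⟨by simpa using ha.1, ha.2⟩
  have h2 : sphere (0 : EuclideanSpace ℝ (Fin (m + 1))) r = r • sphere 0 1 := by
    rw [smul_sphere' hr.ne', smul_zero, Real.norm_of_nonneg hr.le, mul_one]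
  rw [h2, Measure.hausdorffMeasure_smul₀ (Nat.cast_nonneg m) hr.ne', ENNReal.smul_def, smul_eq_mul]
  exact ENNReal.mul_lt_top ENNReal.coe_lt_top h1

/-- The weighted one-dimensional Hardy inequality along a ray. -/
theorem hardy_lintegral_Ioo {V : Type*} [NormedAddCommGroup V] [InnerProductSpace ℝ V]
    {r : ℝ} (hr : 0 < r) (j : ℕ) {g g' : ℝ → V} (hg : ∀ t ∈ Icc 0 r, HasDerivAt g (g' t) t)
    (hg' : ContinuousOn g' (Icc 0 r)) :
    ∫⁻ t in Ioo 0 r, ENNReal.ofReal (t ^ j * ‖g t‖ ^ 2) ≤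
      ENNReal.ofReal (2 / (j + 1) * r ^ (j + 1) * ‖g r‖ ^ 2) +
        ENNReal.ofReal (4 / (j + 1) ^ 2) *
          ∫⁻ t in Ioo 0 r, ENNReal.ofReal (t ^ (j + 2) * ‖g' t‖ ^ 2) := by
  have hgc : ContinuousOn g (Icc 0 r) := fun t ht ↦ (hg t ht).continuousAt.continuousWithinAt
  have hj : (0 : ℝ) < j + 1 := by positivity
  have hconv : ∀ f : ℝ → ℝ, ContinuousOn f (Icc 0 r) → (∀ t ∈ Icc 0 r, 0 ≤ f t) →
      ∫⁻ t in Ioo 0 r, ENNReal.ofReal (f t) = ENNReal.ofReal (∫ t in (0 : ℝ)..r, f t) := by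
    intro f hf h0
    rw [restrict_Ioo_eq_restrict_Ioc, intervalIntegral.integral_of_le hr.le,
      ofReal_integral_eq_lintegral_ofReal]
    · exact (hf.integrableOn_Icc).mono_set Ioc_subset_Icc_self
    · filter_upwards [ae_restrict_mem measurableSet_Ioc] with t ht
        using h0 t (Ioc_subset_Icc_self ht)
  have hc1 : ContinuousOn (fun t ↦ t ^ j * ‖g t‖ ^ 2) (Icc 0 r) := by fun_prop
  have hc2 : ContinuousOn (fun t ↦ t ^ (j + 2) * ‖g' t‖ ^ 2) (Icc 0 r) := by fun_prop
  have hc3 : ContinuousOn (fun t ↦ (((j + 1 : ℕ) : ℝ) * t ^ j) * ‖g t‖ ^ 2 +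
      t ^ (j + 1) * (2 * inner ℝ (g t) (g' t))) (Icc 0 r) := by fun_prop
  have hFTC : ∫ t in (0 : ℝ)..r, ((((j + 1 : ℕ) : ℝ) * t ^ j) * ‖g t‖ ^ 2 +
      t ^ (j + 1) * (2 * inner ℝ (g t) (g' t))) = r ^ (j + 1) * ‖g r‖ ^ 2 := by
    rw [intervalIntegral.integral_eq_sub_of_hasDerivAt
      (f := fun t ↦ t ^ (j + 1) * ‖g t‖ ^ 2)]
    · simp
    · intro t ht
      rw [uIcc_of_le hr.le] at ht
      exact (hasDerivAt_pow (j + 1) t).mul (hg t ht).norm_sq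
    · exact hc3.intervalIntegrable_of_Icc hr.le
  have hreal : ∫ t in (0 : ℝ)..r, t ^ j * ‖g t‖ ^ 2 ≤ 2 / (j + 1) * (r ^ (j + 1) * ‖g r‖ ^ 2) +
      4 / (j + 1) ^ 2 * ∫ t in (0 : ℝ)..r, t ^ (j + 2) * ‖g' t‖ ^ 2 := by
    rw [← hFTC, ← intervalIntegral.integral_const_mul, ← intervalIntegral.integral_const_mul,
      ← intervalIntegral.integral_add]
    · refine intervalIntegral.integral_mono_on hr.le (hc1.intervalIntegrable_of_Icc hr.le)
        (ContinuousOn.intervalIntegrable_of_Icc hr.le (by fun_prop)) fun t ht ↦ ?_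
      have hsq : ‖g t + (2 / ((j : ℝ) + 1) * t) • g' t‖ ^ 2 = ‖g t‖ ^ 2 +
          2 * (2 / ((j : ℝ) + 1) * t) * inner ℝ (g t) (g' t) +
          (2 / ((j : ℝ) + 1) * t) ^ 2 * ‖g' t‖ ^ 2 := by
        rw [norm_add_sq_real, inner_smul_right, norm_smul, mul_pow, Real.norm_eq_abs, sq_abs]
        ring
      have hnn : 0 ≤ t ^ j * ‖g t + (2 / ((j : ℝ) + 1) * t) • g' t‖ ^ 2 :=
        mul_nonneg (pow_nonneg ht.1 _) (sq_nonneg _)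
      rw [hsq] at hnn
      refine sub_nonneg.1 (hnn.trans_eq ?_)
      push_cast
      field_simp
      ring
    · exact ContinuousOn.intervalIntegrable_of_Icc hr.le (by fun_prop)
    · exact ContinuousOn.intervalIntegrable_of_Icc hr.le (by fun_prop)
  rw [hconv _ hc1 fun t ht ↦ mul_nonneg (pow_nonneg ht.1 _) (sq_nonneg _),
    hconv _ hc2 fun t ht ↦ mul_nonneg (pow_nonneg ht.1 _) (sq_nonneg _),
    ← ENNReal.ofReal_mul (by positivity), mul_assoc, ← ENNReal.ofReal_add (by positivity)]
  · exact ENNReal.ofReal_le_ofReal hreal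
  · refine mul_nonneg (by positivity) (intervalIntegral.integral_nonneg hr.le fun t ht ↦ ?_)
    exact mul_nonneg (pow_nonneg ht.1 _) (sq_nonneg _)

theorem norm_apply_sq_le_sum {ι V : Type*} [Fintype ι] [DecidableEq ι] [NormedAddCommGroup V]
    [NormedSpace ℝ V] (L : EuclideanSpace ℝ ι →L[ℝ] V) {ω : EuclideanSpace ℝ ι} (hω : ‖ω‖ = 1) :
    ‖L ω‖ ^ 2 ≤ ∑ i, ‖L (EuclideanSpace.single i 1)‖ ^ 2 := by
  have h1 : ‖L ω‖ ≤ ∑ i, |ω i| * ‖L (EuclideanSpace.single i 1)‖ := by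
    have hsum : ω = ∑ i, ω i • EuclideanSpace.single i (1 : ℝ) := by
      simpa using ((EuclideanSpace.basisFun ι ℝ).sum_repr ω).symm
    conv_lhs => rw [hsum, map_sum]
    refine (norm_sum_le _ _).trans_eq (Finset.sum_congr rfl fun i _ ↦ ?_)
    rw [map_smul, norm_smul, Real.norm_eq_abs]
  calc ‖L ω‖ ^ 2 ≤ (∑ i, |ω i| * ‖L (EuclideanSpace.single i 1)‖) ^ 2 := by gcongr
    _ ≤ (∑ i, |ω i| ^ 2) * ∑ i, ‖L (EuclideanSpace.single i 1)‖ ^ 2 :=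
        Finset.sum_mul_sq_le_sq_mul_sq _ _ _
    _ = _ := by
        simp_rw [sq_abs]
        rw [← EuclideanSpace.real_norm_sq_eq, hω, one_pow, one_mul]

/-- The Hardy inequality on a ball of `ℝⁿ`, `n = j + 3`, for lower Lebesgue integrals. -/
theorem hardy_lintegral_ball {j : ℕ} {V : Type*} [NormedAddCommGroup V] [InnerProductSpace ℝ V]
    {r : ℝ} (hr : 0 < r) {ψ : EuclideanSpace ℝ (Fin (j + 3)) → V}
    {U : Set (EuclideanSpace ℝ (Fin (j + 3)))} (hU : IsOpen U) (hrU : closedBall 0 r ⊆ U)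
    (hψ : ContDiffOn ℝ 1 ψ U) :
    ∫⁻ x in ball (0 : EuclideanSpace ℝ (Fin (j + 3))) r, ENNReal.ofReal (‖ψ x‖ ^ 2 / ‖x‖ ^ 2) ≤
      ENNReal.ofReal (2 / ((j + 1) * r)) *
        ∫⁻ x in sphere (0 : EuclideanSpace ℝ (Fin (j + 3))) r,
          ENNReal.ofReal (‖ψ x‖ ^ 2) ∂μH[((j + 2 : ℕ) : ℝ)] +
      ENNReal.ofReal (4 / (j + 1) ^ 2) *
        ∫⁻ x in ball (0 : EuclideanSpace ℝ (Fin (j + 3))) r,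
          ENNReal.ofReal (∑ i, ‖fderiv ℝ ψ x (EuclideanSpace.single i 1)‖ ^ 2) := by
  have hψc : ContinuousOn ψ U := hψ.continuousOn
  have hdψ : ContinuousOn (fderiv ℝ ψ) U := hψ.continuousOn_fderiv_of_isOpen hU le_rfl
  have hbU : ball 0 r ⊆ U := ball_subset_closedBall.trans hrU
  have hind : ∀ {s : Set (EuclideanSpace ℝ (Fin (j + 3)))}
      {f : EuclideanSpace ℝ (Fin (j + 3)) → ℝ}, MeasurableSet s → ContinuousOn f s →
      Measurable (s.indicator f) := by
    intro s f hs hf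
    classical
    rw [← piecewise_eq_indicator]
    exact hf.measurable_piecewise continuousOn_const hs
  let F : EuclideanSpace ℝ (Fin (j + 3)) → ℝ := (ball 0 r).indicator fun x ↦ ‖ψ x‖ ^ 2
  let H : EuclideanSpace ℝ (Fin (j + 3)) → ℝ := (closedBall 0 r).indicator fun x ↦ ‖ψ x‖ ^ 2
  let G : EuclideanSpace ℝ (Fin (j + 3)) → ℝ := (ball 0 r).indicator
    fun x ↦ ∑ i, ‖fderiv ℝ ψ x (EuclideanSpace.single i 1)‖ ^ 2
  have hF : Measurable F := hind measurableSet_ball ((hψc.mono hbU).norm.pow 2)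
  have hH : Measurable H := hind isClosed_closedBall.measurableSet ((hψc.mono hrU).norm.pow 2)
  have hG : Measurable G := hind measurableSet_ball (continuousOn_finsetSum _ fun i _ ↦
    (((hdψ.mono hbU).clm_apply continuousOn_const).norm.pow 2))
  have hF' : Measurable fun x ↦ ENNReal.ofReal (F x / ‖x‖ ^ 2) :=
    (hF.div (measurable_norm.pow_const 2)).ennreal_ofReal
  have e1 : ∫⁻ x in ball (0 : EuclideanSpace ℝ (Fin (j + 3))) r,
      ENNReal.ofReal (‖ψ x‖ ^ 2 / ‖x‖ ^ 2) = ∫⁻ x, ENNReal.ofReal (F x / ‖x‖ ^ 2) := by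
    rw [← lintegral_indicator measurableSet_ball]
    refine lintegral_congr fun x ↦ ?_
    by_cases hx : x ∈ ball 0 r <;> simp only [F, hx, indicator_of_mem, indicator_of_notMem,
      not_false_eq_true, zero_div, ENNReal.ofReal_zero]
  have e2 : ∫⁻ x in ball (0 : EuclideanSpace ℝ (Fin (j + 3))) r,
      ENNReal.ofReal (∑ i, ‖fderiv ℝ ψ x (EuclideanSpace.single i 1)‖ ^ 2) =
      ∫⁻ x, ENNReal.ofReal (G x) := by
    rw [← lintegral_indicator measurableSet_ball]
    refine lintegral_congr fun x ↦ ?_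
    by_cases hx : x ∈ ball 0 r <;> simp only [G, hx, indicator_of_mem, indicator_of_notMem,
      not_false_eq_true, ENNReal.ofReal_zero]
  have e3 : ∫⁻ x in sphere (0 : EuclideanSpace ℝ (Fin (j + 3))) r,
      ENNReal.ofReal (‖ψ x‖ ^ 2) ∂μH[((j + 2 : ℕ) : ℝ)] =
      ∫⁻ x in sphere (0 : EuclideanSpace ℝ (Fin (j + 3))) r,
      ENNReal.ofReal (H x) ∂μH[((j + 2 : ℕ) : ℝ)] := by
    refine setLIntegral_congr_fun isClosed_sphere.measurableSet fun x hx ↦ ?_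
    simp only [H, indicator_of_mem (sphere_subset_closedBall hx)]
  have hE : Module.finrank ℝ (EuclideanSpace ℝ (Fin (j + 3))) = (j + 2) + 1 := by simp
  have hray : ∀ ω : sphere (0 : EuclideanSpace ℝ (Fin (j + 3))) 1,
      ∫⁻ t in Ioi (0 : ℝ), ENNReal.ofReal (t ^ (j + 2)) *
          ENNReal.ofReal (F (t • ω.1) / ‖t • ω.1‖ ^ 2) ≤
        ENNReal.ofReal (2 / ((j + 1) * r)) *
            (ENNReal.ofReal (r ^ (j + 2)) * ENNReal.ofReal (H (r • ω.1))) +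
          ENNReal.ofReal (4 / (j + 1) ^ 2) * ∫⁻ t in Ioi (0 : ℝ),
            ENNReal.ofReal (t ^ (j + 2)) * ENNReal.ofReal (G (t • ω.1)) := by
    intro ω
    have hω : ‖ω.1‖ = 1 := by simp
    have hn : ∀ t : ℝ, 0 ≤ t → ‖t • ω.1‖ = t := fun t ht ↦ by
      rw [norm_smul, hω, mul_one, Real.norm_of_nonneg ht]
    have hmem : ∀ t ∈ Icc 0 r, t • ω.1 ∈ U := fun t ht ↦ hrU <| by
      simpa [hn t ht.1] using ht.2
    have hd : ∀ t ∈ Icc 0 r,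
        HasDerivAt (fun t : ℝ ↦ ψ (t • ω.1)) (fderiv ℝ ψ (t • ω.1) ω.1) t := fun t ht ↦ by
      have h1 : HasDerivAt (fun t : ℝ ↦ t • ω.1) ω.1 t := by
        simpa using (hasDerivAt_id t).smul_const ω.1
      have h2 := (((hψ.contDiffAt (hU.mem_nhds (hmem t ht))).differentiableAt
        one_ne_zero).hasFDerivAt)
      exact h2.comp_hasDerivAt t h1
    have hcd : ContinuousOn (fun t : ℝ ↦ fderiv ℝ ψ (t • ω.1) ω.1) (Icc 0 r) :=
      (hdψ.comp (by fun_prop) hmem).clm_apply continuousOn_const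
    refine le_trans (le_of_eq ?_) ((hardy_lintegral_Ioo hr j hd hcd).trans
      (add_le_add (le_of_eq ?_) (mul_le_mul_right ?_ _)))
    · rw [← lintegral_indicator measurableSet_Ioo, ← lintegral_indicator measurableSet_Ioi]
      refine lintegral_congr fun t ↦ ?_
      by_cases ht0 : 0 < t
      · rw [indicator_of_mem (mem_Ioi.2 ht0), hn t ht0.le]
        by_cases htr : t < r
        · have hb : t • ω.1 ∈ ball 0 r := by simpa [hn t ht0.le] using htr
          rw [indicator_of_mem (mem_Ioo.2 ⟨ht0, htr⟩), ← ENNReal.ofReal_mul (by positivity)]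
          simp only [F, indicator_of_mem hb]
          congr 1
          field_simp
          ring
        · have hb : t • ω.1 ∉ ball 0 r := by simpa [hn t ht0.le] using htr
          rw [indicator_of_notMem fun h ↦ htr h.2]
          simp only [F, indicator_of_notMem hb, zero_div, ENNReal.ofReal_zero, mul_zero]
      · rw [indicator_of_notMem (by simpa using ht0), indicator_of_notMem fun h ↦ ht0 h.1]
    · have hb : r • ω.1 ∈ closedBall 0 r := by simp [hn r hr.le]
      simp only [H, indicator_of_mem hb]
      rw [← mul_assoc, ← ENNReal.ofReal_mul (by positivity), ← ENNReal.ofReal_mul (by positivity)]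
      congr 2
      field_simp
      ring
    · rw [← lintegral_indicator measurableSet_Ioo, ← lintegral_indicator measurableSet_Ioi]
      refine lintegral_mono fun t ↦ ?_
      by_cases ht : t ∈ Ioo 0 r
      · have hb : t • ω.1 ∈ ball 0 r := by simpa [hn t ht.1.le] using ht.2
        rw [indicator_of_mem ht, indicator_of_mem (mem_Ioi.2 ht.1),
          ← ENNReal.ofReal_mul (pow_nonneg ht.1.le _)]
        simp only [G, indicator_of_mem hb]
        exact ENNReal.ofReal_le_ofReal (mul_le_mul_of_nonneg_left
          (norm_apply_sq_le_sum _ hω) (pow_nonneg ht.1.le _))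
      · rw [indicator_of_notMem ht]
        exact zero_le
  rw [e1, e2, e3, lintegral_eq_lintegral_sphere_lintegral_Ioi hE hF',
    lintegral_eq_lintegral_sphere_lintegral_Ioi hE hG.ennreal_ofReal]
  refine (lintegral_mono hray).trans ?_
  have hHm : Measurable fun ω : sphere (0 : EuclideanSpace ℝ (Fin (j + 3))) 1 ↦
      ENNReal.ofReal (H (r • ω.1)) := (hH.comp (by fun_prop)).ennreal_ofReal
  rw [lintegral_add_left ((hHm.const_mul _).const_mul _),
    lintegral_const_mul' _ _ ENNReal.ofReal_ne_top, lintegral_const_mul' _ _ ENNReal.ofReal_ne_top,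
    lintegral_const_mul' _ _ ENNReal.ofReal_ne_top]
  gcongr
  exact lintegral_toSphere_smul_le hr hH.ennreal_ofReal

/-- Hardy-type inequality for `ℂ^N`-valued maps on a Euclidean ball, `n ≥ 3`. -/
theorem hardy_inequality_spinor {n N : ℕ} (hn : 3 ≤ n) (hN : 1 ≤ N) (r : ℝ) (hr : 0 < r)
    (ψ : EuclideanSpace ℝ (Fin n) → EuclideanSpace ℂ (Fin N))
    (hψ : ∃ U : Set (EuclideanSpace ℝ (Fin n)), IsOpen U ∧
      Metric.closedBall (0 : EuclideanSpace ℝ (Fin n)) r ⊆ U ∧ ContDiffOn ℝ 1 ψ U) :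
    (∫ x in Metric.ball (0 : EuclideanSpace ℝ (Fin n)) r, ‖ψ x‖ ^ 2) ≤
      r ^ 2 * (∫ x in Metric.ball (0 : EuclideanSpace ℝ (Fin n)) r, ‖ψ x‖ ^ 2 / ‖x‖ ^ 2) ∧
    r ^ 2 * (∫ x in Metric.ball (0 : EuclideanSpace ℝ (Fin n)) r, ‖ψ x‖ ^ 2 / ‖x‖ ^ 2) ≤
      (2 / ((n : ℝ) - 2)) * r *
        (∫ x in Metric.sphere (0 : EuclideanSpace ℝ (Fin n)) r, ‖ψ x‖ ^ 2 ∂μH[(n : ℝ) - 1]) +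
      (4 / ((n : ℝ) - 2) ^ 2) * r ^ 2 *
        (∫ x in Metric.ball (0 : EuclideanSpace ℝ (Fin n)) r,
          ∑ j, ‖fderiv ℝ ψ x (EuclideanSpace.single j 1)‖ ^ 2) := by
  obtain ⟨U, hU, hrU, hψ⟩ := hψ
  obtain ⟨j, rfl⟩ := Nat.exists_eq_add_of_le' hn
  have hdim : ((j + 3 : ℕ) : ℝ) - 1 = ((j + 2 : ℕ) : ℝ) := by push_cast; ring
  have hdim2 : ((j + 3 : ℕ) : ℝ) - 2 = (j : ℝ) + 1 := by push_cast; ring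
  rw [hdim, hdim2]
  have hψc : ContinuousOn ψ U := hψ.continuousOn
  have hdψ : ContinuousOn (fderiv ℝ ψ) U := hψ.continuousOn_fderiv_of_isOpen hU le_rfl
  have hA : IntegrableOn (fun x ↦ ‖ψ x‖ ^ 2) (ball 0 r) :=
    (((hψc.mono hrU).norm.pow 2).integrableOn_compact (isCompact_closedBall 0 r)).mono_set
      ball_subset_closedBall
  have hG : IntegrableOn (fun x ↦ ∑ i, ‖fderiv ℝ ψ x (EuclideanSpace.single i 1)‖ ^ 2)
      (ball 0 r) :=
    ((continuousOn_finsetSum _ fun i _ ↦ (((hdψ.mono hrU).clm_apply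
      continuousOn_const).norm.pow 2)).integrableOn_compact (isCompact_closedBall 0 r)).mono_set
      ball_subset_closedBall
  have hS : IntegrableOn (fun x ↦ ‖ψ x‖ ^ 2) (sphere 0 r) μH[((j + 2 : ℕ) : ℝ)] := by
    have : IsFiniteMeasure ((μH[((j + 2 : ℕ) : ℝ)]).restrict
        (sphere (0 : EuclideanSpace ℝ (Fin (j + 3))) r)) :=
      isFiniteMeasure_restrict.2 (hausdorffMeasure_sphere_lt_top hr).ne
    have h := ((hψc.mono (sphere_subset_closedBall.trans hrU)).norm.pow 2).integrableOn_compact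
      (μ := (μH[((j + 2 : ℕ) : ℝ)]).restrict (sphere 0 r)) (isCompact_sphere 0 r)
    rwa [IntegrableOn, Measure.restrict_restrict isClosed_sphere.measurableSet, inter_self] at h
  have main := hardy_lintegral_ball hr hU hrU hψ
  rw [← ofReal_integral_eq_lintegral_ofReal hS (Filter.Eventually.of_forall fun x ↦ by positivity),
    ← ofReal_integral_eq_lintegral_ofReal hG (Filter.Eventually.of_forall fun x ↦ by positivity),
    ← ENNReal.ofReal_mul (by positivity), ← ENNReal.ofReal_mul (by positivity),
    ← ENNReal.ofReal_add (by positivity) (by positivity)] at main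
  have hI : IntegrableOn (fun x ↦ ‖ψ x‖ ^ 2 / ‖x‖ ^ 2) (ball 0 r) := by
    refine (lintegral_ofReal_ne_top_iff_integrable ?_
      (Filter.Eventually.of_forall fun x ↦ by positivity)).1 (main.trans_lt
        ENNReal.ofReal_lt_top).ne
    exact hA.aestronglyMeasurable.aemeasurable.div
      (measurable_norm.pow_const 2).aemeasurable |>.aestronglyMeasurable
  rw [← ofReal_integral_eq_lintegral_ofReal hI (Filter.Eventually.of_forall fun x ↦ by positivity),
    ENNReal.ofReal_le_ofReal_iff (by positivity)] at main
  constructor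
  · rw [← integral_const_mul]
    refine integral_mono_ae hA (hI.const_mul _) ?_
    filter_upwards [ae_restrict_mem measurableSet_ball,
      ae_restrict_of_ae (Measure.ae_ne volume (0 : EuclideanSpace ℝ (Fin (j + 3))))] with x hx hx0
    have hx0' : 0 < ‖x‖ := norm_pos_iff.2 hx0
    have hxr : ‖x‖ < r := by simpa using hx
    rw [mul_div_assoc', le_div_iff₀ (by positivity), mul_comm]
    gcongr
  · refine (mul_le_mul_of_nonneg_left main (sq_nonneg r)).trans_eq ?_
    field_simp
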